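/- Let M ≥ 1 and D ≥ 0 be integers and let Σ be the matrix indexed by ℕ_D^M with entries Σ_{d_A d_B} = ((2D)!(M−1)!/(2D+M−1)!) · C(D; d_A) · C(D; d_B) · C(2D; d_A+d_B)^{−1}. Then Σ is invertible and ∑_{d_A, d_B ∈ ℕ_D^M} Σ_{d_A d_B} · (Σ⁻¹)_{d_A d_B} = C(D+M−1, D), the binomial coefficient "D+M−1 choose D" (which is the cardinality of ℕ_D^M). -/

import Mathlib

open Finset

/-- Fintype instance for the simplex lattice `ℕ_D^M`. -/
instance latticeFintype (M D : ℕ) : Fintype {d : Fin M → ℕ // ∑ i, d i = D} :=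
  Fintype.subtype (Finset.Nat.antidiagonalTuple M D)
    (fun _ => Finset.Nat.mem_antidiagonalTuple)

/-- The matrix entry `Σ_{d_A d_B}` (here `M = m+1`, so `(M-1)! = m!` and
`(2D+M-1)! = (2D+m)!`). -/
noncomputable def sigmaEntry (m D : ℕ) (dA dB : Fin (m+1) → ℕ) : ℝ :=
  ((Nat.factorial (2*D) : ℝ) * (Nat.factorial m) / (Nat.factorial (2*D + m))) *
    (Nat.multinomial Finset.univ dA) * (Nat.multinomial Finset.univ dB) /
    (Nat.multinomial Finset.univ (dA + dB))

lemma aux_vandermonde (D a b : ℕ) (ha : a ≤ D) :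
    ∑ k : Fin (D+1), ((a.choose k : ℝ) * (b.choose k : ℝ)) = ((a + b).choose a : ℝ) := by
  rw [Fin.sum_univ_eq_sum_range (fun k => (a.choose k : ℝ) * (b.choose k : ℝ)) (D+1),
    Nat.add_choose_eq, ← Finset.Nat.sum_antidiagonal_swap,
    Finset.Nat.sum_antidiagonal_eq_sum_range_succ_mk]
  push_cast
  symm
  have h1 : ∀ k ∈ range (a+1), (a.choose (a - k) : ℝ) * (b.choose k : ℝ)
      = (a.choose k : ℝ) * (b.choose k : ℝ) := by
    intro k hk
    rw [Nat.choose_symm (by simpa [Nat.lt_succ_iff] using hk)]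
  simp only [Prod.swap]
  rw [Finset.sum_congr rfl h1]
  apply Finset.sum_subset
  · intro k hk
    simp only [Finset.mem_range] at *
    omega
  · intro k _ hk
    simp only [Finset.mem_range, not_lt] at hk
    rw [Nat.choose_eq_zero_of_lt (by omega)]
    simp

/-- The factor `L` in `Σ = c L Lᵀ`. -/
noncomputable def auxL (m D : ℕ) :
    Matrix {d : Fin (m+1) → ℕ // ∑ i, d i = D} (Fin (m+1) → Fin (D+1)) ℝ :=
  fun a k => ∏ i, ((a.1 i).choose (k i) : ℝ)

lemma aux_le {m D : ℕ} (a : {d : Fin (m+1) → ℕ // ∑ i, d i = D}) (i) : a.1 i ≤ D := by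
  have h := Finset.single_le_sum (f := a.1) (fun _ _ => Nat.zero_le _) (Finset.mem_univ i)
  rwa [a.2] at h

lemma auxL_mul (m D : ℕ) (a b : {d : Fin (m+1) → ℕ // ∑ i, d i = D}) :
    (auxL m D * (auxL m D).conjTranspose) a b = ∏ i, ((a.1 i + b.1 i).choose (a.1 i) : ℝ) := by
  rw [Matrix.mul_apply]
  simp only [auxL, Matrix.conjTranspose_apply, star_trivial, ← Finset.prod_mul_distrib]
  rw [Finset.prod_congr rfl (fun i _ => (aux_vandermonde D (a.1 i) (b.1 i) (aux_le a i)).symm),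
    Finset.prod_univ_sum]
  simp

lemma auxL_inj (m D : ℕ) : Function.Injective (auxL m D).vecMul := by
  have key : ∀ (x : {d : Fin (m+1) → ℕ // ∑ i, d i = D} → ℝ) (k),
      (auxL m D).vecMul x (fun i => ⟨k.1 i, Nat.lt_succ_of_le (aux_le k i)⟩) = x k := by
    intro x k
    simp only [Matrix.vecMul, dotProduct, auxL]
    rw [Finset.sum_eq_single k]
    · simp
    · intro a _ hak
      have : ∃ i, a.1 i < k.1 i := by
        by_contra! h
        apply hak
        have h2 := (Finset.sum_eq_sum_iff_of_le (s := Finset.univ) (fun i _ => h i)).1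
          (k.2.trans a.2.symm)
        exact Subtype.ext (funext fun i => (h2 i (Finset.mem_univ i)).symm)
      obtain ⟨i, hi⟩ := this
      rw [Finset.prod_eq_zero (Finset.mem_univ i), mul_zero]
      exact_mod_cast Nat.choose_eq_zero_of_lt hi
    · simp
  intro x y h
  ext k
  rw [← key x k, ← key y k]
  exact congrFun h _

lemma aux_multinomial {m D : ℕ} (d : Fin (m+1) → ℕ) (h : ∑ i, d i = D) :
    (Nat.multinomial Finset.univ d : ℝ) = (D.factorial : ℝ) / ∏ i, ((d i).factorial : ℝ) := by
  have h0 : (∏ i, ((d i).factorial : ℝ)) ≠ 0 :=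
    Finset.prod_ne_zero_iff.2 fun i _ => by exact_mod_cast (d i).factorial_ne_zero
  rw [eq_div_iff h0, mul_comm, ← h]
  exact_mod_cast Nat.multinomial_spec Finset.univ d

lemma aux_entry (m D : ℕ) : ∃ c : ℝ, c ≠ 0 ∧ ∀ a b : {d : Fin (m+1) → ℕ // ∑ i, d i = D},
    sigmaEntry m D a.1 b.1 = c * ∏ i, ((a.1 i + b.1 i).choose (a.1 i) : ℝ) := by
  have f0 : ∀ n : ℕ, (n.factorial : ℝ) ≠ 0 := fun n => by exact_mod_cast n.factorial_ne_zero
  have p0 : ∀ d : Fin (m+1) → ℕ, (∏ i, ((d i).factorial : ℝ)) ≠ 0 := fun d =>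
    Finset.prod_ne_zero_iff.2 fun i _ => f0 _
  refine ⟨(m.factorial : ℝ) * D.factorial * D.factorial / (2*D+m).factorial, ?_, ?_⟩
  · exact div_ne_zero (mul_ne_zero (mul_ne_zero (f0 _) (f0 _)) (f0 _)) (f0 _)
  · intro a b
    have hab : ∑ i, (a.1 + b.1) i = 2 * D := by
      simp only [Pi.add_apply, Finset.sum_add_distrib, a.2, b.2]; ring
    have hc : ∏ i, ((a.1 i + b.1 i).choose (a.1 i) : ℝ) =
        (∏ i, (((a.1 + b.1) i).factorial : ℝ)) /
          ((∏ i, ((a.1 i).factorial : ℝ)) * ∏ i, ((b.1 i).factorial : ℝ)) := by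
      rw [← Finset.prod_mul_distrib, ← Finset.prod_div_distrib]
      refine Finset.prod_congr rfl fun i _ => ?_
      rw [add_comm (a.1 i), Nat.add_choose, Pi.add_apply, Nat.cast_div (Nat.factorial_mul_factorial_dvd_factorial_add _ _)
        (by exact_mod_cast mul_ne_zero (f0 _) (f0 _))]
      push_cast
      rw [add_comm (a.1 i), mul_comm ((b.1 i).factorial : ℝ)]
    rw [hc, sigmaEntry, aux_multinomial _ a.2, aux_multinomial _ b.2, aux_multinomial _ hab]
    have h1 := p0 a.1
    have h2 := p0 b.1
    have h3 := p0 (a.1 + b.1)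
    have h4 := f0 (2*D)
    have h5 := f0 (2*D+m)
    field_simp

/-- `Σ` is invertible and `∑_{d_A,d_B} Σ_{d_A d_B} (Σ⁻¹)_{d_A d_B}`
equals the binomial coefficient `C(D+M-1, D)` (here `M = m+1`). -/
theorem sigmaMatrix_hadamard_inv_sum (m D : ℕ)
    (S : Matrix {d : Fin (m+1) → ℕ // ∑ i, d i = D}
                {d : Fin (m+1) → ℕ // ∑ i, d i = D} ℝ)
    (hS : ∀ dA dB, S dA dB = sigmaEntry m D dA.1 dB.1) :
    IsUnit S.det ∧
      ∑ dA, ∑ dB, S dA dB * S⁻¹ dA dB = ((D + m).choose D : ℝ) := by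
  obtain ⟨c, hc, hent⟩ := aux_entry m D
  have hSeq : S = c • (auxL m D * (auxL m D).conjTranspose) := by
    ext a b
    rw [hS, hent, Matrix.smul_apply, auxL_mul, smul_eq_mul]
  have hdet : IsUnit S.det := by
    rw [hSeq, Matrix.det_smul, isUnit_iff_ne_zero]
    exact mul_ne_zero (pow_ne_zero _ hc)
      (Matrix.PosDef.mul_conjTranspose_self _ (auxL_inj m D)).det_pos.ne'
  refine ⟨hdet, ?_⟩
  have hsymm : S.transpose = S := by
    ext a b
    rw [Matrix.transpose_apply, hS, hS, sigmaEntry, sigmaEntry, add_comm b.1 a.1]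
    ring
  have hrow : ∀ a, ∑ b, S a b * S⁻¹ a b = 1 := by
    intro a
    have h1 : (S * S⁻¹) a a = 1 := by rw [Matrix.mul_nonsing_inv _ hdet, Matrix.one_apply_eq]
    rw [Matrix.mul_apply] at h1
    rw [← h1]
    refine Finset.sum_congr rfl fun b _ => ?_
    rw [← Matrix.transpose_apply S⁻¹ a b, Matrix.transpose_nonsing_inv, hsymm]
  rw [Finset.sum_congr rfl (fun a _ => hrow a)]
  simp only [Finset.sum_const, nsmul_eq_mul, mul_one, Finset.card_univ]
  rw [← Fintype.card_congr (Sym.equivNatSumOfFintype (Fin (m+1)) D), Sym.card_sym_eq_choose,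
    Fintype.card_fin]
  congr 2
  omega
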